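/- Fix 0 ≤ β_1 < β_2 < 1 and ε > 0. Let (x_s), (v_{s,i}), b_{s,i} be generated by the Adam recursion from arbitrary g_s ∈ ℝ^d, write ḡ_{s,i} := ∇f(x_s)_i, and assume the coordinate-wise affine variance noise condition. Define the proxy step-size a_{s,i} := √( β_2·v_{s−1,i} + (1−β_2)·(σ_{0,i}² + (1+σ_{1,i}²)·ḡ_{s,i}²) ) + ε_s. Then for every i ∈ [d] and every s ≥ 1: | 1/a_{s,i} − 1/b_{s,i} | ≤ (2·√(1−β_2) / (a_{s,i}·b_{s,i}))·√( σ_{0,i}² + σ_{1,i}²·ḡ_{s,i}² ). -/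

import Mathlib

theorem sqrt_le_sqrt_add_of_sq_le {A B C p : ℝ} (hB : 0 ≤ B) (hC : 0 ≤ C) (hp : p ^ 2 ≤ B)
    (hA : A ≤ B + 2 * C * p + C ^ 2) : √A ≤ √B + C := by
  have hpB : p ≤ √B := Real.le_sqrt_of_sq_le hp
  refine Real.sqrt_le_iff.2 ⟨by positivity, ?_⟩
  nlinarith [Real.sq_sqrt hB, mul_le_mul_of_nonneg_left hpB hC]

theorem abs_sqrt_sub_sqrt_le_of_abs_sub_le {u r N g h : ℝ} (hu : 0 ≤ u) (hr : 0 ≤ r)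
    (hgh : |g - h| ≤ N) :
    |√(u + r ^ 2 * (N ^ 2 + h ^ 2)) - √(u + r ^ 2 * g ^ 2)| ≤ 2 * r * N := by
  have hN : 0 ≤ N := (abs_nonneg _).trans hgh
  have hg : |g| ≤ |h| + N := by
    linarith [abs_sub_abs_le_abs_sub g h]
  have hh : |h| ≤ |g| + N := by
    linarith [abs_sub_abs_le_abs_sub h g, abs_sub_comm g h]
  have hg2 : g ^ 2 ≤ (|h| + N) ^ 2 := by
    rw [← sq_abs g]; gcongr
  have hh2 : h ^ 2 ≤ (|g| + N) ^ 2 := by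
    rw [← sq_abs h]; gcongr
  have hrN : 0 ≤ r ^ 2 * N * |g| := by positivity
  have hrN' : 0 ≤ r ^ 2 * N * |h| := by positivity
  have hrNN : 0 ≤ r ^ 2 * N ^ 2 := by positivity
  rw [abs_sub_le_iff]
  constructor
  · rw [sub_le_iff_le_add']
    refine sqrt_le_sqrt_add_of_sq_le (p := r * |g|) (by positivity) (by positivity) ?_ ?_
    · rw [mul_pow, sq_abs]; linarith
    · nlinarith [mul_le_mul_of_nonneg_left hh2 (sq_nonneg r), sq_abs g]
  · rw [sub_le_iff_le_add']
    refine sqrt_le_sqrt_add_of_sq_le (p := r * |h|) (by positivity) (by positivity) ?_ ?_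
    · rw [mul_pow, sq_abs]; nlinarith
    · nlinarith [mul_le_mul_of_nonneg_left hg2 (sq_nonneg r), sq_abs h]


theorem stmt16 (d : ℕ) (hd : 1 ≤ d)
    (β1 β2 η ε : ℝ)
    (hβ1 : 0 ≤ β1) (hβ12 : β1 < β2) (hβ2 : β2 < 1) (hε : 0 < ε)
    (f : EuclideanSpace ℝ (Fin d) → ℝ)
    (hdiff : Differentiable ℝ f)
    (σ0 σ1 : Fin d → ℝ) (hσ0 : ∀ i, 0 < σ0 i) (hσ1 : ∀ i, 0 < σ1 i)
    (g m v : ℕ → Fin d → ℝ) (x : ℕ → EuclideanSpace ℝ (Fin d))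
    (ηs εs : ℕ → ℝ) (b a : ℕ → Fin d → ℝ)
    (hm0 : ∀ i, m 0 i = 0) (hv0 : ∀ i, v 0 i = 0)
    (hm : ∀ s, 1 ≤ s → ∀ i, m s i = β1 * m (s - 1) i + (1 - β1) * g s i)
    (hv : ∀ s, 1 ≤ s → ∀ i, v s i = β2 * v (s - 1) i + (1 - β2) * (g s i) ^ 2)
    (hηs : ∀ s, 1 ≤ s → ηs s = η * Real.sqrt (1 - β2 ^ s) / (1 - β1 ^ s))
    (hεs : ∀ s, 1 ≤ s → εs s = ε * Real.sqrt (1 - β2 ^ s))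
    (hx : ∀ s, 1 ≤ s → ∀ i,
      x (s + 1) i = x s i - ηs s * m s i / (Real.sqrt (v s i) + εs s))
    (hb : ∀ s, 1 ≤ s → ∀ i, b s i = Real.sqrt (v s i) + εs s)
    (ha : ∀ s, 1 ≤ s → ∀ i, a s i =
      Real.sqrt (β2 * v (s - 1) i +
        (1 - β2) * ((σ0 i) ^ 2 + (1 + (σ1 i) ^ 2) * (gradient f (x s) i) ^ 2)) + εs s)
    (hnoise : ∀ s, 1 ≤ s → ∀ i,
      (g s i - gradient f (x s) i) ^ 2 ≤ (σ0 i) ^ 2 + (σ1 i) ^ 2 * (gradient f (x s) i) ^ 2) :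
    ∀ s, 1 ≤ s → ∀ i : Fin d,
      |1 / a s i - 1 / b s i| ≤
        2 * Real.sqrt (1 - β2) / (a s i * b s i) *
          Real.sqrt ((σ0 i) ^ 2 + (σ1 i) ^ 2 * (gradient f (x s) i) ^ 2) := by
  intro s hs i
  have hβ2_nonneg : 0 ≤ β2 := hβ1.trans hβ12.le
  have hv_nonneg : ∀ n, 0 ≤ v n i := by
    intro n
    induction n with
    | zero => exact (hv0 i).ge
    | succ n ih =>
      rw [hv (n + 1) (by omega) i, Nat.add_sub_cancel]
      have : 0 ≤ 1 - β2 := by linarith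
      positivity
  have hε_pos : 0 < εs s := by
    rw [hεs s hs]
    have : 0 < 1 - β2 ^ s := sub_pos.2 (pow_lt_one₀ hβ2_nonneg hβ2 (by omega))
    positivity
  have ha_pos : 0 < a s i := by
    rw [ha s hs i]; positivity
  have hb_pos : 0 < b s i := by
    rw [hb s hs i]; positivity
  have hdist : |a s i - b s i| ≤ 2 * √(1 - β2) *
      √((σ0 i) ^ 2 + (σ1 i) ^ 2 * (gradient f (x s) i) ^ 2) := by
    have key := abs_sqrt_sub_sqrt_le_of_abs_sub_le
      (mul_nonneg hβ2_nonneg (hv_nonneg (s - 1))) (Real.sqrt_nonneg (1 - β2))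
      (Real.abs_le_sqrt (hnoise s hs i))
    rw [Real.sq_sqrt (by linarith : 0 ≤ 1 - β2), Real.sq_sqrt (by positivity)] at key
    rw [ha s hs i, hb s hs i, hv s hs i, add_sub_add_right_eq_sub]
    convert key using 5
    ring
  rw [div_sub_div _ _ ha_pos.ne' hb_pos.ne', abs_div, abs_of_pos (mul_pos ha_pos hb_pos),
    one_mul, mul_one, abs_sub_comm, div_mul_eq_mul_div]
  gcongr
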